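/- If f ∈ L_1(G_m) on a bounded Vilenkin group, then the Vilenkin-Fejér means converge almost everywhere: σ_n^ψ f → f a.e. as n → ∞. -/

import Mathlib

open MeasureTheory Filter Complex

/-- The (bounded) Vilenkin group `G_m = ∏_k Z_{m_k}`. -/
abbrev VilGroup (m : ℕ → ℕ) : Type := Π k, ZMod (m k)

/-- The generalized powers `M_0 = 1`, `M_{k+1} = m_k M_k`. -/
def Mgen (m : ℕ → ℕ) : ℕ → ℕ
  | 0 => 1
  | k + 1 => m k * Mgen m k

/-- The `j`-th digit of `n` in the `M`-adic (mixed radix) number system. -/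
def vDigit (m : ℕ → ℕ) (n j : ℕ) : ℕ := (n / Mgen m j) % m j

/-- The generalized Rademacher functions `r_k(x) = exp(2πi x_k / m_k)`. -/
noncomputable def rademacher (m : ℕ → ℕ) (k : ℕ) (x : VilGroup m) : ℂ :=
  Complex.exp (2 * Real.pi * Complex.I * ((x k).val : ℂ) / (m k : ℂ))

/-- The Vilenkin functions `ψ_n = ∏_k r_k^{n_k}`. -/
noncomputable def vilenkin (m : ℕ → ℕ) (n : ℕ) (x : VilGroup m) : ℂ :=
  ∏ j ∈ Finset.range (n + 1), (rademacher m j x) ^ (vDigit m n j)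

/-- The Vilenkin-Dirichlet kernels `D_k^ψ = ∑_{j<k} ψ_j`. -/
noncomputable def vilenkinDirichlet (m : ℕ → ℕ) (k : ℕ) (x : VilGroup m) : ℂ :=
  ∑ j ∈ Finset.range k, vilenkin m j x

/-- The Vilenkin-Fejér kernels `K_n^ψ = (1/n) ∑_{k<n} D_k^ψ`. -/
noncomputable def vilenkinFejer (m : ℕ → ℕ) (n : ℕ) (x : VilGroup m) : ℂ :=
  (1 / n) * ∑ k ∈ Finset.range n, vilenkinDirichlet m k x

/-- The cylinder `I_N = I_N(0) = {y : y_0 = ⋯ = y_{N-1} = 0}`. -/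
def cylV (m : ℕ → ℕ) (N : ℕ) : Set (VilGroup m) := {y | ∀ j < N, y j = 0}

/-- The Vilenkin interval `I_N(x)`. -/
def cylVAt (m : ℕ → ℕ) (N : ℕ) (x : VilGroup m) : Set (VilGroup m) :=
  {y | ∀ j < N, y j = x j}

/-- `μ` is the normalized Haar measure on `G_m`, characterized by
`μ(I_N(x)) = 1/M_N` for every cylinder. -/
def IsVilHaar (m : ℕ → ℕ) (μ : Measure (VilGroup m)) : Prop :=
  ∀ (N : ℕ) (x : VilGroup m), μ (cylVAt m N x) = (Mgen m N : ENNReal)⁻¹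

/-- The `k`-th Vilenkin-Fourier coefficient. -/
noncomputable def vCoef (m : ℕ → ℕ) (μ : Measure (VilGroup m))
    (f : VilGroup m → ℂ) (k : ℕ) : ℂ :=
  ∫ x, f x * (starRingEnd ℂ) (vilenkin m k x) ∂μ

/-- The partial sums `S_n^ψ f` of the Vilenkin-Fourier series. -/
noncomputable def vPartialSum (m : ℕ → ℕ) (μ : Measure (VilGroup m))
    (f : VilGroup m → ℂ) (n : ℕ) (x : VilGroup m) : ℂ :=
  ∑ k ∈ Finset.range n, vCoef m μ f k * vilenkin m k x

/-- The Vilenkin-Fejér means `σ_n^ψ f = (1/n) ∑_{k<n} S_k^ψ f`. -/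
noncomputable def vFejerMean (m : ℕ → ℕ) (μ : Measure (VilGroup m))
    (f : VilGroup m → ℂ) (n : ℕ) (x : VilGroup m) : ℂ :=
  (1 / n) * ∑ k ∈ Finset.range n, vPartialSum m μ f k x

section Mixed_radix

variable {m : ℕ → ℕ}

lemma Mgen_pos [∀ k, NeZero (m k)] (k : ℕ) : 0 < Mgen m k := by
  induction k with
  | zero => simp [Mgen]
  | succ k ih => exact Nat.mul_pos (NeZero.pos (m k)) ih

lemma Mgen_dvd {k l : ℕ} (h : k ≤ l) : Mgen m k ∣ Mgen m l := by
  induction l, h using Nat.le_induction with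
  | base => exact dvd_rfl
  | succ l _ ih => exact ih.mul_left _

lemma Mgen_mono [∀ k, NeZero (m k)] : Monotone (Mgen m) :=
  fun _ l h => Nat.le_of_dvd (Mgen_pos l) (Mgen_dvd h)

lemma two_mul_Mgen_le (hm : ∀ k, 2 ≤ m k) (k : ℕ) : 2 * Mgen m k ≤ Mgen m (k + 1) :=
  Nat.mul_le_mul_right _ (hm k)

lemma lt_Mgen (hm : ∀ k, 2 ≤ m k) (k : ℕ) : k < Mgen m k := by
  induction k with
  | zero => simp [Mgen]
  | succ k ih => have := two_mul_Mgen_le hm k; omega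

lemma sum_Mgen_le (hm : ∀ k, 2 ≤ m k) (k : ℕ) :
    ∑ s ∈ Finset.range k, Mgen m s ≤ Mgen m k := by
  induction k with
  | zero => simp
  | succ k ih => rw [Finset.sum_range_succ]; have := two_mul_Mgen_le hm k; omega

lemma sum_Mgen_succ_le (hm : ∀ k, 2 ≤ m k) (k : ℕ) :
    ∑ s ∈ Finset.range k, Mgen m (s + 1) ≤ 2 * Mgen m k := by
  have h := Finset.sum_range_succ' (Mgen m) k
  rw [Finset.sum_range_succ] at h
  have := sum_Mgen_le hm k
  omega

lemma vDigit_eq_zero {n j : ℕ} (h : n < Mgen m j) : vDigit m n j = 0 := by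
  simp [vDigit, Nat.div_eq_of_lt h]

lemma vDigit_block_low [∀ k, NeZero (m k)] {i l : ℕ} (h : i < l) (q j : ℕ) :
    vDigit m (q * Mgen m l + j) i = vDigit m j i := by
  obtain ⟨t, ht⟩ := Mgen_dvd (m := m) (Nat.succ_le_of_lt h)
  have e : q * Mgen m l + j = j + Mgen m i * (m i * (q * t)) := by
    rw [ht]; simp only [Mgen]; ring
  rw [vDigit, vDigit, e, Nat.add_mul_div_left _ _ (Mgen_pos i), Nat.add_mul_mod_self_left]

lemma vDigit_block_top [∀ k, NeZero (m k)] {l q j : ℕ} (hq : q < m l) (hj : j < Mgen m l) :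
    vDigit m (q * Mgen m l + j) l = q := by
  rw [vDigit, mul_comm, Nat.mul_add_div (Mgen_pos l), Nat.div_eq_of_lt hj, add_zero,
    Nat.mod_eq_of_lt hq]

lemma block_lt {l q j : ℕ} (hq : q < m l) (hj : j < Mgen m l) :
    q * Mgen m l + j < Mgen m (l + 1) :=
  calc q * Mgen m l + j < (q + 1) * Mgen m l := by rw [add_mul, one_mul]; omega
    _ ≤ Mgen m (l + 1) := Nat.mul_le_mul_right _ hq

/-- A positive index has a nonzero leading digit. -/
lemma exists_vDigit_ne_zero (hm : ∀ k, 2 ≤ m k) {N j : ℕ} (h : Mgen m N ≤ j) :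
    ∃ l, N ≤ l ∧ vDigit m j l ≠ 0 := by
  have : ∀ k, NeZero (m k) := fun k => ⟨by have := hm k; omega⟩
  classical
  have hex : ∃ K, j < Mgen m K := ⟨j, lt_Mgen hm j⟩
  obtain ⟨K, hK, hmin⟩ : ∃ K, j < Mgen m K ∧ ∀ K' < K, ¬ j < Mgen m K' :=
    ⟨Nat.find hex, Nat.find_spec hex, fun _ h => Nat.find_min hex h⟩
  have hNK : N < K := by
    by_contra! hc
    have := Mgen_mono (m := m) hc
    omega
  obtain ⟨l, rfl⟩ : ∃ l, K = l + 1 := ⟨K - 1, by omega⟩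
  have hl := hmin l (by omega)
  have h1 : 1 ≤ j / Mgen m l := (Nat.one_le_div_iff (Mgen_pos l)).2 (by omega)
  have h2 : j / Mgen m l < m l := Nat.div_lt_of_lt_mul (by rw [mul_comm]; exact hK)
  refine ⟨l, by omega, ?_⟩
  rw [vDigit, Nat.mod_eq_of_lt h2]
  omega

end Mixed_radix

section Characters

variable {m : ℕ → ℕ} [∀ k, NeZero (m k)]

lemma rademacher_eq_stdAddChar (k : ℕ) (x : VilGroup m) :
    rademacher m k x = ZMod.stdAddChar (x k) := by
  rw [ZMod.stdAddChar_apply, ZMod.toCircle_apply, rademacher]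

lemma rademacher_add (k : ℕ) (x y : VilGroup m) :
    rademacher m k (x + y) = rademacher m k x * rademacher m k y := by
  simp [rademacher_eq_stdAddChar, AddChar.map_add_eq_mul]

lemma rademacher_neg (k : ℕ) (x : VilGroup m) :
    rademacher m k (-x) = (starRingEnd ℂ) (rademacher m k x) := by
  simp [rademacher_eq_stdAddChar, AddChar.map_neg_eq_conj]

lemma norm_rademacher (k : ℕ) (x : VilGroup m) : ‖rademacher m k x‖ = 1 := by
  rw [rademacher_eq_stdAddChar, ZMod.stdAddChar_apply, Circle.norm_coe]

lemma rademacher_pow_self (k : ℕ) (x : VilGroup m) : rademacher m k x ^ m k = 1 := by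
  rw [rademacher_eq_stdAddChar, ← AddChar.map_nsmul_eq_pow]
  simp

lemma rademacher_eq_one_iff {k : ℕ} {x : VilGroup m} : rademacher m k x = 1 ↔ x k = 0 := by
  rw [rademacher_eq_stdAddChar, ← AddChar.map_zero_eq_one (ZMod.stdAddChar (N := m k)),
    ZMod.injective_stdAddChar.eq_iff]

lemma sum_rademacher_pow (k : ℕ) (x : VilGroup m) :
    ∑ i ∈ Finset.range (m k), rademacher m k x ^ i = if x k = 0 then (m k : ℂ) else 0 := by
  split_ifs with h
  · simp [rademacher_eq_one_iff.2 h]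
  · have h1 : rademacher m k x ≠ 1 := fun h' => h (rademacher_eq_one_iff.1 h')
    rw [geom_sum_eq h1, rademacher_pow_self, sub_self, zero_div]

lemma vilenkin_add (n : ℕ) (x y : VilGroup m) :
    vilenkin m n (x + y) = vilenkin m n x * vilenkin m n y := by
  simp [vilenkin, rademacher_add, mul_pow, Finset.prod_mul_distrib]

lemma vilenkin_neg (n : ℕ) (x : VilGroup m) :
    vilenkin m n (-x) = (starRingEnd ℂ) (vilenkin m n x) := by
  simp [vilenkin, rademacher_neg]

lemma vilenkin_sub (n : ℕ) (x y : VilGroup m) :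
    vilenkin m n (x - y) = vilenkin m n x * (starRingEnd ℂ) (vilenkin m n y) := by
  rw [sub_eq_add_neg, vilenkin_add, vilenkin_neg]

lemma norm_vilenkin (n : ℕ) (x : VilGroup m) : ‖vilenkin m n x‖ = 1 := by
  simp [vilenkin, norm_rademacher]

lemma vilenkin_eq_prod_range (hm : ∀ k, 2 ≤ m k) {n K : ℕ} (h : n < Mgen m K) (x : VilGroup m) :
    vilenkin m n x = ∏ j ∈ Finset.range K, rademacher m j x ^ vDigit m n j := by
  have key : ∀ K', n < Mgen m K' → ∀ j ∈ Finset.range (max (n + 1) K), j ∉ Finset.range K' →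
      rademacher m j x ^ vDigit m n j = 1 := by
    intro K' hK' j _ hj
    rw [vDigit_eq_zero (hK'.trans_le (Mgen_mono (by simpa using hj))), pow_zero]
  rw [vilenkin, Finset.prod_subset (Finset.range_mono (le_max_left _ _))
      (key _ ((Nat.lt_succ_self n).trans (lt_Mgen hm _))),
    ← Finset.prod_subset (Finset.range_mono (le_max_right _ _)) (key _ h)]

lemma vilenkin_block (hm : ∀ k, 2 ≤ m k) {l q j : ℕ} (hq : q < m l) (hj : j < Mgen m l)
    (x : VilGroup m) :
    vilenkin m (q * Mgen m l + j) x = rademacher m l x ^ q * vilenkin m j x := by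
  rw [vilenkin_eq_prod_range hm (block_lt hq hj), vilenkin_eq_prod_range hm hj,
    Finset.prod_range_succ, vDigit_block_top hq hj, mul_comm]
  congr 1
  exact Finset.prod_congr rfl fun i hi => by rw [vDigit_block_low (Finset.mem_range.1 hi)]

end Characters

section Kernels

variable {m : ℕ → ℕ} [∀ k, NeZero (m k)]

lemma vilenkinDirichlet_block (hm : ∀ k, 2 ≤ m k) {l q k : ℕ} (hq : q < m l) (hk : k ≤ Mgen m l)
    (x : VilGroup m) :
    vilenkinDirichlet m (q * Mgen m l + k) x =
      vilenkinDirichlet m (q * Mgen m l) x + rademacher m l x ^ q * vilenkinDirichlet m k x := by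
  rw [vilenkinDirichlet, Finset.sum_range_add, vilenkinDirichlet, vilenkinDirichlet,
    Finset.mul_sum]
  congr 1
  exact Finset.sum_congr rfl fun j hj =>
    vilenkin_block hm hq ((Finset.mem_range.1 hj).trans_le hk) x

lemma vilenkinDirichlet_mul_Mgen (hm : ∀ k, 2 ≤ m k) {l q : ℕ} (hq : q ≤ m l) (x : VilGroup m) :
    vilenkinDirichlet m (q * Mgen m l) x =
      (∑ i ∈ Finset.range q, rademacher m l x ^ i) * vilenkinDirichlet m (Mgen m l) x := by
  induction q with
  | zero => simp [vilenkinDirichlet]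
  | succ q ih =>
    rw [add_mul, one_mul, vilenkinDirichlet_block hm hq le_rfl, ih (by omega),
      Finset.sum_range_succ, add_mul]

/-- The indicator function of the cylinder `I_l`. -/
noncomputable def cylInd (m : ℕ → ℕ) (l : ℕ) : VilGroup m → ℕ := (cylV m l).indicator 1

omit [∀ k, NeZero (m k)] in
lemma mem_cylV_succ (l : ℕ) (x : VilGroup m) : x ∈ cylV m (l + 1) ↔ x ∈ cylV m l ∧ x l = 0 :=
  Nat.forall_lt_succ_right

omit [∀ k, NeZero (m k)] in
lemma cylInd_succ_of_eq_zero {l : ℕ} {x : VilGroup m} (h : x l = 0) :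
    cylInd m (l + 1) x = cylInd m l x := by
  classical
  simp [cylInd, Set.indicator_apply, mem_cylV_succ, h]

omit [∀ k, NeZero (m k)] in
lemma cylInd_succ_of_ne_zero {l : ℕ} {x : VilGroup m} (h : x l ≠ 0) :
    cylInd m (l + 1) x = 0 := by
  simp [cylInd, mem_cylV_succ, h]

/-- Paley's lemma: `D_{M_l} = M_l 1_{I_l}`. -/
lemma vilenkinDirichlet_Mgen (hm : ∀ k, 2 ≤ m k) (l : ℕ) (x : VilGroup m) :
    vilenkinDirichlet m (Mgen m l) x = Mgen m l * cylInd m l x := by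
  induction l with
  | zero => simp [vilenkinDirichlet, Mgen, cylInd, vilenkin, vDigit, cylV]
  | succ l ih =>
    rw [Mgen, vilenkinDirichlet_mul_Mgen hm le_rfl, ih, sum_rademacher_pow]
    split_ifs with h
    · simp [mul_assoc, cylInd_succ_of_eq_zero h]
    · simp [cylInd_succ_of_ne_zero h]

lemma norm_sum_rademacher_pow_le (l q : ℕ) (x : VilGroup m) :
    ‖∑ i ∈ Finset.range q, rademacher m l x ^ i‖ ≤ q := by
  refine (norm_sum_le _ _).trans ?_
  simp [norm_rademacher]

lemma norm_vilenkinDirichlet_mul_Mgen_le (hm : ∀ k, 2 ≤ m k) {l q : ℕ} (hq : q ≤ m l)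
    (x : VilGroup m) :
    ‖vilenkinDirichlet m (q * Mgen m l) x‖ ≤ q * (Mgen m l * cylInd m l x) := by
  rw [vilenkinDirichlet_mul_Mgen hm hq, norm_mul, vilenkinDirichlet_Mgen hm]
  refine mul_le_mul (norm_sum_rademacher_pow_le _ _ _) (by simp) (norm_nonneg _) (by positivity)

/-- The unnormalized Fejér kernel `n K_n`. -/
noncomputable def fejerSum (m : ℕ → ℕ) (n : ℕ) (x : VilGroup m) : ℂ :=
  ∑ k ∈ Finset.range n, vilenkinDirichlet m k x

lemma fejerSum_block (hm : ∀ k, 2 ≤ m k) {l q k : ℕ} (hq : q < m l) (hk : k ≤ Mgen m l)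
    (x : VilGroup m) :
    fejerSum m (q * Mgen m l + k) x = fejerSum m (q * Mgen m l) x +
      k * vilenkinDirichlet m (q * Mgen m l) x + rademacher m l x ^ q * fejerSum m k x := by
  have h : ∀ j ∈ Finset.range k, vilenkinDirichlet m (q * Mgen m l + j) x =
      vilenkinDirichlet m (q * Mgen m l) x + rademacher m l x ^ q * vilenkinDirichlet m j x :=
    fun j hj => vilenkinDirichlet_block hm hq ((Finset.mem_range.1 hj).le.trans hk) x
  rw [fejerSum, Finset.sum_range_add, Finset.sum_congr rfl h, Finset.sum_add_distrib,
    ← Finset.mul_sum, fejerSum, fejerSum]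
  simp [add_assoc]

lemma fejerSum_mul_Mgen (hm : ∀ k, 2 ≤ m k) {l q : ℕ} (hq : q ≤ m l) (x : VilGroup m) :
    fejerSum m (q * Mgen m l) x =
      Mgen m l * ∑ i ∈ Finset.range q, vilenkinDirichlet m (i * Mgen m l) x +
      (∑ i ∈ Finset.range q, rademacher m l x ^ i) * fejerSum m (Mgen m l) x := by
  induction q with
  | zero => simp [fejerSum]
  | succ q ih =>
    rw [add_mul, one_mul, fejerSum_block hm hq le_rfl, ih (by omega),
      Finset.sum_range_succ, Finset.sum_range_succ]
    ring

lemma norm_Mgen_mul_sum_vilenkinDirichlet_le (hm : ∀ k, 2 ≤ m k) {B : ℕ} (hB : ∀ k, m k ≤ B)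
    {l q : ℕ} (hq : q ≤ m l) (x : VilGroup m) :
    ‖Mgen m l * ∑ i ∈ Finset.range q, vilenkinDirichlet m (i * Mgen m l) x‖ ≤
      (B ^ 2 * Mgen m l * (Mgen m l * cylInd m l x) : ℕ) := by
  have hqB : (q : ℝ) ≤ B := by exact_mod_cast hq.trans (hB l)
  have h : ∀ i ∈ Finset.range q, ‖vilenkinDirichlet m (i * Mgen m l) x‖ ≤
      B * (Mgen m l * cylInd m l x) := by
    intro i hi
    have hi' := (Finset.mem_range.1 hi).le
    refine (norm_vilenkinDirichlet_mul_Mgen_le hm (hi'.trans hq) x).trans ?_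
    have : (i : ℝ) ≤ B := by exact_mod_cast (hi'.trans hq).trans (hB l)
    gcongr
  have h2 := (norm_sum_le _ _).trans (Finset.sum_le_sum h)
  rw [Finset.sum_const, Finset.card_range, nsmul_eq_mul] at h2
  rw [norm_mul, Complex.norm_natCast]
  push_cast
  calc (Mgen m l : ℝ) * ‖∑ i ∈ Finset.range q, vilenkinDirichlet m (i * Mgen m l) x‖
      ≤ Mgen m l * (B * (B * (Mgen m l * cylInd m l x))) := by
        gcongr
        exact h2.trans (by gcongr)
    _ = _ := by ring

/-- The cylinder `I_l` with the condition on the coordinate `s` removed. -/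
def puncturedCyl (m : ℕ → ℕ) (l s : ℕ) : Set (VilGroup m) := {x | ∀ i < l, i ≠ s → x i = 0}

/-- The majorant of the Fejér kernels. -/
noncomputable def fejerMajorant (m : ℕ → ℕ) (l : ℕ) (x : VilGroup m) : ℕ :=
  ∑ s ∈ Finset.range (l + 1), Mgen m s * (puncturedCyl m l s).indicator 1 x

omit [∀ k, NeZero (m k)] in
lemma puncturedCyl_self (l : ℕ) : puncturedCyl m l l = cylV m l := by
  ext x
  exact forall₂_congr fun i hi => by simp [hi.ne]

omit [∀ k, NeZero (m k)] in
lemma puncturedCyl_succ_self (l : ℕ) : puncturedCyl m (l + 1) l = cylV m l := by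
  ext x
  refine Nat.forall_lt_succ_right.trans ?_
  simp only [ne_eq, not_true_eq_false, false_imp_iff, and_true]
  exact forall₂_congr fun i hi => by simp [hi.ne]

omit [∀ k, NeZero (m k)] in
lemma mem_puncturedCyl_succ {l s : ℕ} (h : s < l) (x : VilGroup m) :
    x ∈ puncturedCyl m (l + 1) s ↔ x ∈ puncturedCyl m l s ∧ x l = 0 := by
  refine Nat.forall_lt_succ_right.trans (and_congr_right fun _ => ?_)
  simp [h.ne']

omit [∀ k, NeZero (m k)] in
lemma Mgen_mul_cylInd_le_fejerMajorant (l : ℕ) (x : VilGroup m) :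
    Mgen m l * cylInd m l x ≤ fejerMajorant m l x := by
  rw [fejerMajorant, Finset.sum_range_succ, puncturedCyl_self, cylInd]
  exact Nat.le_add_left _ _

omit [∀ k, NeZero (m k)] in
lemma fejerMajorant_succ_of_eq_zero {l : ℕ} {x : VilGroup m} (h : x l = 0) :
    fejerMajorant m (l + 1) x = fejerMajorant m l x + Mgen m (l + 1) * cylInd m l x := by
  classical
  rw [fejerMajorant, fejerMajorant, Finset.sum_range_succ, Finset.sum_range_succ,
    Finset.sum_range_succ _ l, puncturedCyl_self, puncturedCyl_self, puncturedCyl_succ_self,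
    ← cylInd, ← cylInd, cylInd_succ_of_eq_zero h]
  congr 2
  refine Finset.sum_congr rfl fun s hs => ?_
  simp [Set.indicator_apply, mem_puncturedCyl_succ (Finset.mem_range.1 hs), h]

omit [∀ k, NeZero (m k)] in
lemma fejerMajorant_succ_of_ne_zero {l : ℕ} {x : VilGroup m} (h : x l ≠ 0) :
    fejerMajorant m (l + 1) x = Mgen m l * cylInd m l x := by
  classical
  rw [fejerMajorant, Finset.sum_range_succ, Finset.sum_range_succ, puncturedCyl_self,
    puncturedCyl_succ_self, ← cylInd, ← cylInd, cylInd_succ_of_ne_zero h, Finset.sum_eq_zero]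
  · simp
  · intro s hs
    simp [mem_puncturedCyl_succ (Finset.mem_range.1 hs), h]

lemma norm_fejerSum_Mgen_le (hm : ∀ k, 2 ≤ m k) {B : ℕ} (hB : ∀ k, m k ≤ B)
    (l : ℕ) (x : VilGroup m) :
    ‖fejerSum m (Mgen m l) x‖ ≤ (B ^ 2 * Mgen m l * fejerMajorant m l x : ℕ) := by
  induction l with
  | zero => simp only [fejerSum, Mgen, vilenkinDirichlet]; simp; positivity
  | succ l ih =>
    have hM : Mgen m l ≤ Mgen m (l + 1) := Mgen_mono l.le_succ
    have h1 := norm_Mgen_mul_sum_vilenkinDirichlet_le hm hB (le_refl (m l)) x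
    rw [show Mgen m (l + 1) = m l * Mgen m l from rfl, fejerSum_mul_Mgen hm le_rfl,
      sum_rademacher_pow]
    change _ ≤ ((B ^ 2 * Mgen m (l + 1) * fejerMajorant m (l + 1) x : ℕ) : ℝ)
    split_ifs with hx
    · have h2 : ‖(m l : ℂ) * fejerSum m (Mgen m l) x‖ ≤
          (B ^ 2 * Mgen m (l + 1) * fejerMajorant m l x : ℕ) := by
        rw [norm_mul, Complex.norm_natCast]
        calc (m l : ℝ) * ‖fejerSum m (Mgen m l) x‖
            ≤ m l * (B ^ 2 * Mgen m l * fejerMajorant m l x : ℕ) := by gcongr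
          _ = _ := by rw [Mgen]; push_cast; ring
      refine (norm_add_le _ _).trans ((add_le_add h1 h2).trans ?_)
      norm_cast
      rw [fejerMajorant_succ_of_eq_zero hx]
      calc B ^ 2 * Mgen m l * (Mgen m l * cylInd m l x) +
            B ^ 2 * Mgen m (l + 1) * fejerMajorant m l x
          ≤ B ^ 2 * Mgen m (l + 1) * (Mgen m (l + 1) * cylInd m l x) +
            B ^ 2 * Mgen m (l + 1) * fejerMajorant m l x := by gcongr
        _ = _ := by ring
    · rw [zero_mul, add_zero, fejerMajorant_succ_of_ne_zero hx]
      refine h1.trans ?_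
      norm_cast
      gcongr

lemma norm_fejerSum_le (hm : ∀ k, 2 ≤ m k) {B : ℕ} (hB : ∀ k, m k ≤ B)
    {L n : ℕ} (hn : n < Mgen m L) (x : VilGroup m) :
    ‖fejerSum m n x‖ ≤ ((B ^ 3 + B ^ 2 + B) *
      ∑ l ∈ Finset.range L, Mgen m l * fejerMajorant m l x : ℕ) := by
  induction L generalizing n with
  | zero =>
    obtain rfl : n = 0 := by simpa [Mgen] using hn
    simp [fejerSum]
  | succ L ih =>
    set q := n / Mgen m L
    set r := n % Mgen m L
    have hr : r < Mgen m L := Nat.mod_lt _ (Mgen_pos L)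
    have hq : q < m L := Nat.div_lt_of_lt_mul (by rw [mul_comm]; exact hn)
    have hqB : q ≤ B := hq.le.trans (hB L)
    have hn' : n = q * Mgen m L + r := by rw [mul_comm]; exact (Nat.div_add_mod _ _).symm
    have hQ := Mgen_mul_cylInd_le_fejerMajorant L x
    have h1 := norm_Mgen_mul_sum_vilenkinDirichlet_le hm hB hq.le x
    have h2 : ‖(∑ i ∈ Finset.range q, rademacher m L x ^ i) * fejerSum m (Mgen m L) x‖ ≤
        (B * (B ^ 2 * Mgen m L * fejerMajorant m L x) : ℕ) := by
      rw [norm_mul, Nat.cast_mul]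
      exact mul_le_mul ((norm_sum_rademacher_pow_le _ _ _).trans (by exact_mod_cast hqB))
        (norm_fejerSum_Mgen_le hm hB L x) (norm_nonneg _) (by positivity)
    have h3 : ‖(r : ℂ) * vilenkinDirichlet m (q * Mgen m L) x‖ ≤
        (Mgen m L * (B * (Mgen m L * cylInd m L x)) : ℕ) := by
      rw [norm_mul, Complex.norm_natCast, Nat.cast_mul]
      refine mul_le_mul (by exact_mod_cast hr.le)
        ((norm_vilenkinDirichlet_mul_Mgen_le hm hq.le x).trans ?_) (norm_nonneg _) (by positivity)
      norm_cast
      gcongr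
    have h4 : ‖rademacher m L x ^ q * fejerSum m r x‖ ≤ ((B ^ 3 + B ^ 2 + B) *
        ∑ l ∈ Finset.range L, Mgen m l * fejerMajorant m l x : ℕ) := by
      rw [norm_mul, norm_pow, norm_rademacher, one_pow, one_mul]
      exact ih hr
    rw [hn', fejerSum_block hm hq hr.le, fejerSum_mul_Mgen hm hq.le]
    refine (norm_add_le _ _).trans ((add_le_add ((norm_add_le _ _).trans
      (add_le_add ((norm_add_le _ _).trans (add_le_add h1 h2)) h3)) h4).trans ?_)
    norm_cast
    rw [Finset.sum_range_succ]
    calc _ ≤ B ^ 2 * Mgen m L * fejerMajorant m L x + B * (B ^ 2 * Mgen m L * fejerMajorant m L x)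
          + Mgen m L * (B * fejerMajorant m L x) + (B ^ 3 + B ^ 2 + B) *
            ∑ l ∈ Finset.range L, Mgen m l * fejerMajorant m l x := by gcongr
      _ = _ := by ring

end Kernels

section Haar

variable {m : ℕ → ℕ}

lemma cylVAt_congr {N : ℕ} {x y : VilGroup m} (h : ∀ j < N, y j = x j) :
    cylVAt m N y = cylVAt m N x := by
  ext z
  exact forall₂_congr fun j hj => by rw [h j hj]

lemma cylVAt_anti {K N : ℕ} (h : K ≤ N) (x : VilGroup m) : cylVAt m N x ⊆ cylVAt m K x :=
  fun _ hy j hj => hy j (hj.trans_le h)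

lemma measurableSet_cylVAt (N : ℕ) (x : VilGroup m) : MeasurableSet (cylVAt m N x) := by
  have : cylVAt m N x = ⋂ j, ⋂ (_ : j < N), (fun y : VilGroup m => y j) ⁻¹' {x j} := by
    ext y; simp [cylVAt]
  rw [this]
  exact .iInter fun j => .iInter fun _ => measurable_pi_apply j (.singleton _)

lemma isPiSystem_cylVAt : IsPiSystem {s | ∃ N x, s = cylVAt m N x} := by
  rintro _ ⟨N, x, rfl⟩ _ ⟨K, y, rfl⟩ ⟨z, hzx, hzy⟩
  refine ⟨max N K, z, ?_⟩
  rw [← cylVAt_congr hzx, ← cylVAt_congr hzy]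
  ext w
  refine ⟨fun h j hj => ?_, fun h => ⟨fun j hj => h j (by simp [hj]), fun j hj => h j (by simp [hj])⟩⟩
  rcases lt_max_iff.1 hj with hj | hj
  exacts [h.1 j hj, h.2 j hj]

lemma generateFrom_cylVAt [∀ k, NeZero (m k)] :
    (MeasurableSpace.pi : MeasurableSpace (VilGroup m)) =
      MeasurableSpace.generateFrom {s | ∃ N x, s = cylVAt m N x} := by
  refine le_antisymm (iSup_le fun k => ?_) (MeasurableSpace.generateFrom_le ?_)
  · rintro _ ⟨t, -, rfl⟩
    let ext (z : Π i : Fin (k + 1), ZMod (m i)) : VilGroup m :=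
      fun i => if h : i < k + 1 then z ⟨i, h⟩ else 0
    have : (fun y : VilGroup m => y k) ⁻¹' t =
        ⋃ z ∈ {z : Π i : Fin (k + 1), ZMod (m i) | z (Fin.last k) ∈ t},
          cylVAt m (k + 1) (ext z) := by
      ext y
      simp only [Set.mem_preimage, Set.mem_iUnion, exists_prop]
      constructor
      · intro hy
        exact ⟨fun i => y i, hy, fun j hj => by rw [show ext (fun i => y i) j = y j from dif_pos hj]⟩
      · rintro ⟨z, hz, hy⟩
        have h := hy k k.lt_succ_self
        simp only [ext, Nat.lt_succ_self, dif_pos] at h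
        rw [h]
        exact hz
    rw [this]
    refine @MeasurableSet.biUnion _ _ (_) _ _ (Set.to_countable _) fun z _ => ?_
    exact MeasurableSpace.measurableSet_generateFrom ⟨_, _, rfl⟩
  · rintro _ ⟨N, x, rfl⟩
    exact measurableSet_cylVAt N x

lemma IsVilHaar.isAddRightInvariant [∀ k, NeZero (m k)] {μ : Measure (VilGroup m)}
    [IsProbabilityMeasure μ] (hμ : IsVilHaar m μ) : μ.IsAddRightInvariant := by
  refine ⟨fun g => ?_⟩
  have : IsProbabilityMeasure (μ.map (· + g)) :=
    Measure.isProbabilityMeasure_map (measurable_add_const g).aemeasurable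
  refine ext_of_generate_finite _ generateFrom_cylVAt isPiSystem_cylVAt ?_ (by simp)
  rintro _ ⟨N, x, rfl⟩
  rw [Measure.map_apply (measurable_add_const g) (measurableSet_cylVAt N x), hμ N x,
    ← hμ N (x - g)]
  congr 1
  ext y
  exact forall₂_congr fun j _ => by simp [eq_sub_iff_add_eq]

lemma measurableSet_setOf_mem_cylVAt (N : ℕ) :
    MeasurableSet {p : VilGroup m × VilGroup m | p.2 ∈ cylVAt m N p.1} := by
  have : {p : VilGroup m × VilGroup m | p.2 ∈ cylVAt m N p.1} =
      ⋂ j, ⋂ (_ : j < N), {p | p.2 j = p.1 j} := by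
    ext y; simp [cylVAt]
  rw [this]
  have hc : ∀ n, Countable (ZMod n)
    | 0 => inferInstanceAs (Countable ℤ)
    | n + 1 => inferInstanceAs (Countable (Fin (n + 1)))
  refine .iInter fun j => .iInter fun _ => ?_
  have := hc (m j)
  exact ((((measurable_pi_apply j).comp measurable_snd).prodMk
    ((measurable_pi_apply j).comp measurable_fst)) :
      Measurable fun p : VilGroup m × VilGroup m => (p.2 j, p.1 j)) (.of_discrete (s := {q : ZMod (m j) × ZMod (m j) | q.1 = q.2}))

end Haar

section Weak_type

variable {m : ℕ → ℕ}

/-- The integral of `g` over the cylinder `I_N(x)`. -/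
noncomputable def cylLIntegral (μ : Measure (VilGroup m)) (g : VilGroup m → ENNReal) (N : ℕ)
    (x : VilGroup m) : ENNReal :=
  ∫⁻ y in cylVAt m N x, g y ∂μ

variable {μ : Measure (VilGroup m)} {g : VilGroup m → ENNReal} {lam : ENNReal}

lemma cylLIntegral_congr {N : ℕ} {x y : VilGroup m} (h : ∀ j < N, y j = x j) :
    cylLIntegral μ g N y = cylLIntegral μ g N x := by
  rw [cylLIntegral, cylVAt_congr h, cylLIntegral]

lemma cylLIntegral_eq_lintegral_indicator (N : ℕ) (x : VilGroup m) :
    cylLIntegral μ g N x =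
      ∫⁻ y, {p : VilGroup m × VilGroup m | p.2 ∈ cylVAt m N p.1}.indicator (g ∘ Prod.snd)
        (x, y) ∂μ := by
  rw [cylLIntegral, ← lintegral_indicator (measurableSet_cylVAt N x)]
  rfl

lemma measurable_indicator_cylVAt (hg : Measurable g) (N : ℕ) :
    Measurable ({p : VilGroup m × VilGroup m | p.2 ∈ cylVAt m N p.1}.indicator
      (g ∘ Prod.snd)) :=
  (hg.comp measurable_snd).indicator (measurableSet_setOf_mem_cylVAt N)

lemma measurable_cylLIntegral [SFinite μ] (hg : Measurable g) (N : ℕ) :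
    Measurable (cylLIntegral μ g N) := by
  simp_rw [funext (cylLIntegral_eq_lintegral_indicator (μ := μ) (g := g) N)]
  exact (measurable_indicator_cylVAt hg N).lintegral_prod_right'

/-- Averaging over the cylinders of level `N` preserves integrals over sets depending only on
the first `N` coordinates. -/
lemma setLIntegral_cylLIntegral [∀ k, NeZero (m k)] [SFinite μ] (hμ : IsVilHaar m μ)
    (hg : Measurable g) {N : ℕ} {S : Set (VilGroup m)} (hS : MeasurableSet S)
    (hlevel : ∀ x ∈ S, cylVAt m N x ⊆ S) :
    ∫⁻ x in S, Mgen m N * cylLIntegral μ g N x ∂μ = ∫⁻ x in S, g x ∂μ := by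
  have hM0 : (Mgen m N : ENNReal) ≠ 0 := by exact_mod_cast (Mgen_pos N).ne'
  have hsymm : ∀ x y : VilGroup m, y ∈ cylVAt m N x ↔ x ∈ cylVAt m N y := fun x y =>
    forall₂_congr fun j _ => eq_comm
  rw [lintegral_const_mul _ (measurable_cylLIntegral hg N)]
  simp_rw [cylLIntegral_eq_lintegral_indicator]
  rw [lintegral_lintegral_swap (f := fun x y => {p : VilGroup m × VilGroup m |
    p.2 ∈ cylVAt m N p.1}.indicator (g ∘ Prod.snd) (x, y))
    (measurable_indicator_cylVAt hg N).aemeasurable]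
  have h : ∀ y, ∫⁻ x in S, {p : VilGroup m × VilGroup m | p.2 ∈ cylVAt m N p.1}.indicator
      (g ∘ Prod.snd) (x, y) ∂μ = S.indicator (fun y => (Mgen m N : ENNReal)⁻¹ * g y) y := by
    intro y
    have h1 : ∀ x, {p : VilGroup m × VilGroup m | p.2 ∈ cylVAt m N p.1}.indicator
        (g ∘ Prod.snd) (x, y) = (cylVAt m N y).indicator (fun _ => g y) x := by
      intro x
      by_cases hx : y ∈ cylVAt m N x
      · rw [Set.indicator_of_mem (show (x, y) ∈ _ from hx),
          Set.indicator_of_mem ((hsymm x y).1 hx)]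
        rfl
      · rw [Set.indicator_of_notMem (show (x, y) ∉ _ from hx),
          Set.indicator_of_notMem (fun h => hx ((hsymm x y).2 h))]
    simp_rw [h1]
    rw [lintegral_indicator_const (measurableSet_cylVAt N y),
      Measure.restrict_apply (measurableSet_cylVAt N y)]
    by_cases hy : y ∈ S
    · rw [Set.inter_eq_left.2 (hlevel y hy), hμ, Set.indicator_of_mem hy, mul_comm]
    · have : cylVAt m N y ∩ S = ∅ := by
        ext x
        simp only [Set.mem_inter_iff, Set.mem_empty_iff_false, iff_false, not_and]
        exact fun hx hxS => hy (hlevel x hxS ((hsymm x y).2 hx))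
      rw [this, measure_empty, mul_zero, Set.indicator_of_notMem hy]
  simp_rw [h]
  rw [lintegral_indicator hS, lintegral_const_mul _ hg, ← mul_assoc,
    ENNReal.mul_inv_cancel hM0 (ENNReal.natCast_ne_top _), one_mul]

/-- The points whose first cylinder with average exceeding `lam` has level `N`. -/
def stopSet (μ : Measure (VilGroup m)) (g : VilGroup m → ENNReal) (lam : ENNReal) (N : ℕ) :
    Set (VilGroup m) :=
  {x | lam < Mgen m N * cylLIntegral μ g N x ∧ ∀ K < N, Mgen m K * cylLIntegral μ g K x ≤ lam}

lemma exists_mem_stopSet {l : ℕ} {x : VilGroup m}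
    (h : lam < Mgen m l * cylLIntegral μ g l x) : ∃ N ≤ l, x ∈ stopSet μ g lam N := by
  classical
  have hex : ∃ N, lam < Mgen m N * cylLIntegral μ g N x := ⟨l, h⟩
  exact ⟨Nat.find hex, Nat.find_min' hex h, Nat.find_spec hex,
    fun K hK => not_lt.1 (Nat.find_min hex hK)⟩

lemma cylVAt_subset_stopSet {N : ℕ} {x : VilGroup m} (hx : x ∈ stopSet μ g lam N) :
    cylVAt m N x ⊆ stopSet μ g lam N := by
  intro y hy
  refine ⟨by rw [cylLIntegral_congr hy]; exact hx.1, fun K hK => ?_⟩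
  rw [cylLIntegral_congr fun j hj => hy j (hj.trans hK)]
  exact hx.2 K hK

lemma measurableSet_stopSet [SFinite μ] (hg : Measurable g) (N : ℕ) :
    MeasurableSet (stopSet μ g lam N) := by
  have hA : ∀ K, Measurable fun x => (Mgen m K : ENNReal) * cylLIntegral μ g K x :=
    fun K => (measurable_cylLIntegral hg K).const_mul _
  have : stopSet μ g lam N = {x | lam < Mgen m N * cylLIntegral μ g N x} ∩
      ⋂ K, ⋂ (_ : K < N), {x | Mgen m K * cylLIntegral μ g K x ≤ lam} := by
    ext x; simp [stopSet]
  rw [this]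
  exact (measurableSet_lt measurable_const (hA N)).inter
    (.iInter fun K => .iInter fun _ => measurableSet_le (hA K) measurable_const)

lemma pairwise_disjoint_stopSet : Pairwise (Function.onFun Disjoint (stopSet μ g lam)) := by
  have key : ∀ K N, K < N → Disjoint (stopSet μ g lam K) (stopSet μ g lam N) := fun K N h =>
    Set.disjoint_left.2 fun x hK hN => (hN.2 K h).not_gt hK.1
  intro K N h
  rcases lt_or_gt_of_ne h with h | h
  exacts [key _ _ h, (key _ _ h).symm]

lemma tsum_setLIntegral_stopSet_le [SFinite μ] (hg : Measurable g) :
    ∑' N, ∫⁻ x in stopSet μ g lam N, g x ∂μ ≤ ∫⁻ x, g x ∂μ := by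
  rw [← lintegral_iUnion (fun N => measurableSet_stopSet hg N) pairwise_disjoint_stopSet]
  exact setLIntegral_le_lintegral _ _

/-- The weak type (1,1) bound for the martingale maximal function. -/
lemma mul_measure_iUnion_stopSet_le [∀ k, NeZero (m k)] [SFinite μ] (hμ : IsVilHaar m μ)
    (hg : Measurable g) : lam * μ (⋃ N, stopSet μ g lam N) ≤ ∫⁻ x, g x ∂μ := by
  rw [measure_iUnion pairwise_disjoint_stopSet fun N => measurableSet_stopSet hg N,
    ← ENNReal.tsum_mul_left]
  refine le_trans (ENNReal.tsum_le_tsum fun N => ?_) (tsum_setLIntegral_stopSet_le (lam := lam) hg)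
  rw [← setLIntegral_cylLIntegral hμ hg (measurableSet_stopSet hg N)
    (fun x hx => cylVAt_subset_stopSet hx), ← setLIntegral_const]
  exact setLIntegral_mono ((measurable_cylLIntegral hg N).const_mul _) fun x hx => hx.1.le

/-- The mass of the stopping cylinder of `x`, counted only when its level exceeds `s`. -/
noncomputable def stopMass (μ : Measure (VilGroup m)) (g : VilGroup m → ENNReal) (lam : ENNReal)
    (s : ℕ) (x : VilGroup m) : ENNReal :=
  ∑' N, if s < N then (stopSet μ g lam N).indicator (cylLIntegral μ g N) x else 0

/-- The contribution of the stopping cylinders met after changing one coordinate of `x`. -/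
noncomputable def shiftedStopMass [∀ k, NeZero (m k)] (μ : Measure (VilGroup m))
    (g : VilGroup m → ENNReal) (lam : ENNReal) (x : VilGroup m) : ENNReal :=
  ∑' s, ∑ a : ZMod (m s), Mgen m s * stopMass μ g lam s (x + Pi.single s a)

lemma measurable_stopMass [SFinite μ] (hg : Measurable g) (s : ℕ) :
    Measurable (stopMass μ g lam s) := by
  refine Measurable.tsum fun N => ?_
  split_ifs
  · exact (measurable_cylLIntegral hg N).indicator (measurableSet_stopSet hg N)
  · exact measurable_const

lemma measurable_mul_stopMass_add [SFinite μ] (hg : Measurable g) (s : ℕ) (a : ZMod (m s)) :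
    Measurable fun x : VilGroup m => (Mgen m s : ENNReal) * stopMass μ g lam s (x + Pi.single s a) :=
  ((measurable_stopMass hg s).comp (measurable_add_const _)).const_mul _

variable [∀ k, NeZero (m k)]

lemma measurable_shiftedStopMass [SFinite μ] (hg : Measurable g) :
    Measurable (shiftedStopMass μ g lam) :=
  Measurable.tsum fun s => Finset.measurable_fun_sum _ fun a _ =>
    measurable_mul_stopMass_add hg s a

lemma lintegral_shiftedStopMass_le (hm : ∀ k, 2 ≤ m k) [IsProbabilityMeasure μ]
    (hμ : IsVilHaar m μ) (hg : Measurable g) :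
    ∫⁻ x, shiftedStopMass μ g lam x ∂μ ≤ 2 * ∫⁻ x, g x ∂μ := by
  have := hμ.isAddRightInvariant
  have h1 : ∀ s, ∫⁻ x, ∑ a : ZMod (m s), Mgen m s * stopMass μ g lam s (x + Pi.single s a) ∂μ =
      ∑' N, (if s < N then (Mgen m (s + 1) : ENNReal) else 0) *
        ∫⁻ x in stopSet μ g lam N, cylLIntegral μ g N x ∂μ := by
    intro s
    rw [lintegral_finsetSum _ fun a _ => measurable_mul_stopMass_add hg s a]
    have h2 : ∀ a : ZMod (m s),
        ∫⁻ x, Mgen m s * stopMass μ g lam s (x + Pi.single s a) ∂μ =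
          Mgen m s * ∫⁻ x, stopMass μ g lam s x ∂μ := by
      intro a
      rw [lintegral_add_right_eq_self fun x => Mgen m s * stopMass μ g lam s x,
        lintegral_const_mul _ (measurable_stopMass hg s)]
    simp_rw [h2]
    rw [Finset.sum_const, Finset.card_univ, ZMod.card, nsmul_eq_mul, ← mul_assoc, ← Nat.cast_mul]
    change (Mgen m (s + 1) : ENNReal) * _ = _
    simp_rw [stopMass]
    rw [lintegral_tsum, ← ENNReal.tsum_mul_left]
    · refine tsum_congr fun N => ?_
      split_ifs
      · rw [lintegral_indicator (measurableSet_stopSet hg N)]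
      · simp
    · intro N
      split_ifs
      · exact ((measurable_cylLIntegral hg N).indicator (measurableSet_stopSet hg N)).aemeasurable
      · exact aemeasurable_const
  simp_rw [shiftedStopMass]
  rw [lintegral_tsum fun s => (Finset.measurable_fun_sum _ fun a _ =>
    measurable_mul_stopMass_add hg s a).aemeasurable]
  simp_rw [h1]
  rw [ENNReal.tsum_comm]
  calc _ ≤ ∑' N, 2 * ∫⁻ x in stopSet μ g lam N, g x ∂μ := by
        refine ENNReal.tsum_le_tsum fun N => ?_
        rw [ENNReal.tsum_mul_right, ← setLIntegral_cylLIntegral hμ hg (measurableSet_stopSet hg N)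
          (fun x hx => cylVAt_subset_stopSet hx),
          lintegral_const_mul _ (measurable_cylLIntegral hg N), ← mul_assoc]
        gcongr
        rw [tsum_eq_sum (s := Finset.range N) fun s hs => if_neg (by simpa using hs),
          Finset.sum_congr rfl fun s hs => if_pos (Finset.mem_range.1 hs)]
        exact_mod_cast sum_Mgen_succ_le hm N
    _ ≤ _ := by
        rw [ENNReal.tsum_mul_left]
        gcongr
        exact tsum_setLIntegral_stopSet_le hg

/-- The convolution of `g` with the majorant of the Fejér kernels. -/
noncomputable def majorantConv (μ : Measure (VilGroup m)) (g : VilGroup m → ENNReal) (l : ℕ)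
    (x : VilGroup m) : ENNReal :=
  ∑ s ∈ Finset.range (l + 1), Mgen m s * ∫⁻ y in {y | x - y ∈ puncturedCyl m l s}, g y ∂μ

lemma setLIntegral_puncturedCyl_le (l s : ℕ) (x : VilGroup m) :
    ∫⁻ y in {y | x - y ∈ puncturedCyl m l s}, g y ∂μ ≤
      ∑ a : ZMod (m s), cylLIntegral μ g l (x + Pi.single s a) := by
  have hsub : {y | x - y ∈ puncturedCyl m l s} ⊆
      ⋃ a : ZMod (m s), cylVAt m l (x + Pi.single s a) := by
    intro y hy
    refine Set.mem_iUnion.2 ⟨y s - x s, fun i hi => ?_⟩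
    by_cases his : i = s
    · subst his; simp
    · have := hy i hi his
      rw [Pi.sub_apply, sub_eq_zero] at this
      simp [his, this]
  refine (lintegral_mono_set hsub).trans ((lintegral_iUnion_le _ _).trans ?_)
  rw [tsum_fintype]
  rfl

lemma cylLIntegral_shift_le {x : VilGroup m} (hx : x ∉ ⋃ N, stopSet μ g lam N) (l s : ℕ)
    (a : ZMod (m s)) :
    cylLIntegral μ g l (x + Pi.single s a) ≤
      lam / Mgen m l + stopMass μ g lam s (x + Pi.single s a) := by
  have hM0 : (Mgen m l : ENNReal) ≠ 0 := by exact_mod_cast (Mgen_pos l).ne'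
  set y := x + Pi.single s a with hy
  by_cases h : lam < Mgen m l * cylLIntegral μ g l y
  · obtain ⟨N, hNl, hN⟩ := exists_mem_stopSet h
    have hsN : s < N := by
      by_contra! hc
      refine hx (Set.mem_iUnion.2 ⟨N, cylVAt_subset_stopSet hN fun j hj => ?_⟩)
      simp [hy, (hj.trans_le hc).ne]
    refine le_add_left ?_
    calc cylLIntegral μ g l y ≤ cylLIntegral μ g N y := lintegral_mono_set (cylVAt_anti hNl y)
      _ = if s < N then (stopSet μ g lam N).indicator (cylLIntegral μ g N) y else 0 := by
        rw [if_pos hsN, Set.indicator_of_mem hN]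
      _ ≤ _ := ENNReal.le_tsum N
  · refine le_add_right ?_
    rw [ENNReal.le_div_iff_mul_le (.inl hM0) (.inl (ENNReal.natCast_ne_top _)), mul_comm]
    exact not_lt.1 h

lemma majorantConv_le (hm : ∀ k, 2 ≤ m k) {B : ℕ} (hB : ∀ k, m k ≤ B) {x : VilGroup m}
    (hx : x ∉ ⋃ N, stopSet μ g lam N) (l : ℕ) :
    majorantConv μ g l x ≤ 2 * B * lam + shiftedStopMass μ g lam x := by
  have hM0 : (Mgen m l : ENNReal) ≠ 0 := by exact_mod_cast (Mgen_pos l).ne'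
  calc majorantConv μ g l x
      ≤ ∑ s ∈ Finset.range (l + 1), Mgen m s * ∑ a : ZMod (m s),
          (lam / Mgen m l + stopMass μ g lam s (x + Pi.single s a)) := by
        refine Finset.sum_le_sum fun s _ => ?_
        gcongr
        exact (setLIntegral_puncturedCyl_le l s x).trans
          (Finset.sum_le_sum fun a _ => cylLIntegral_shift_le hx l s a)
    _ = (∑ s ∈ Finset.range (l + 1), Mgen m (s + 1) : ℕ) * (lam / Mgen m l) +
          ∑ s ∈ Finset.range (l + 1), ∑ a : ZMod (m s),
            Mgen m s * stopMass μ g lam s (x + Pi.single s a) := by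
        simp_rw [Finset.sum_add_distrib, mul_add, Finset.sum_add_distrib, ← Finset.mul_sum]
        congr 1
        push_cast
        rw [Finset.sum_mul]
        refine Finset.sum_congr rfl fun s _ => ?_
        rw [Finset.sum_const, Finset.card_univ, ZMod.card, nsmul_eq_mul, ← mul_assoc, Mgen]
        push_cast
        ring
    _ ≤ _ := by
        refine add_le_add ?_ (ENNReal.sum_le_tsum _)
        calc ((∑ s ∈ Finset.range (l + 1), Mgen m (s + 1) : ℕ) : ENNReal) * (lam / Mgen m l)
            ≤ (2 * (B * Mgen m l) : ℕ) * (lam / Mgen m l) := by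
              gcongr
              exact (sum_Mgen_succ_le hm _).trans
                (Nat.mul_le_mul_left _ (Nat.mul_le_mul_right _ (hB l)))
          _ = 2 * B * (Mgen m l * (lam / Mgen m l)) := by push_cast; ring
          _ = _ := by rw [ENNReal.mul_div_cancel hM0 (ENNReal.natCast_ne_top _)]

/-- The weak type (1,1) bound for the maximal operator of the majorants. -/
lemma mul_measure_majorantConv_le (hm : ∀ k, 2 ≤ m k) {B : ℕ} (hB : ∀ k, m k ≤ B)
    [IsProbabilityMeasure μ] (hμ : IsVilHaar m μ) (hg : Measurable g) :
    lam * μ {x | ∃ l, (2 * B + 1) * lam < majorantConv μ g l x} ≤ 3 * ∫⁻ x, g x ∂μ := by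
  have hsub : {x | ∃ l, (2 * B + 1) * lam < majorantConv μ g l x} ⊆
      (⋃ N, stopSet μ g lam N) ∪ {x | lam ≤ shiftedStopMass μ g lam x} := by
    rintro x ⟨l, hl⟩
    by_cases hx : x ∈ ⋃ N, stopSet μ g lam N
    · exact .inl hx
    · refine .inr ?_
      have h := hl.trans_le (majorantConv_le hm hB hx l)
      rw [add_mul, one_mul] at h
      exact (lt_of_add_lt_add_left h).le
  calc lam * μ {x | ∃ l, (2 * B + 1) * lam < majorantConv μ g l x}
      ≤ lam * μ (⋃ N, stopSet μ g lam N) + lam * μ {x | lam ≤ shiftedStopMass μ g lam x} := by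
        rw [← mul_add]
        gcongr
        exact (measure_mono hsub).trans (measure_union_le _ _)
    _ ≤ ∫⁻ x, g x ∂μ + 2 * ∫⁻ x, g x ∂μ :=
        add_le_add (mul_measure_iUnion_stopSet_le hμ hg)
          ((mul_meas_ge_le_lintegral (measurable_shiftedStopMass hg) _).trans
            (lintegral_shiftedStopMass_le hm hμ hg))
    _ = 3 * ∫⁻ x, g x ∂μ := by ring

end Weak_type

section Convolution

variable {m : ℕ → ℕ} [∀ k, NeZero (m k)] {μ : Measure (VilGroup m)} {f : VilGroup m → ℂ}

lemma measurable_rademacher (k : ℕ) : Measurable (rademacher m k) := by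
  rw [funext (rademacher_eq_stdAddChar (m := m) k)]
  exact Measurable.of_discrete.comp (measurable_pi_apply k)

lemma measurable_vilenkin (n : ℕ) : Measurable (vilenkin m n) :=
  Finset.measurable_fun_prod _ fun j _ => (measurable_rademacher j).pow_const _

lemma integrable_mul_vilenkin_sub (hf : Integrable f μ) (k : ℕ) (x : VilGroup m) :
    Integrable (fun y => f y * vilenkin m k (x - y)) μ :=
  hf.mul_bdd (c := 1) ((measurable_vilenkin k).comp (measurable_const_sub x)).aestronglyMeasurable
    (.of_forall fun _ => (norm_vilenkin k _).le)

lemma vCoef_mul_vilenkin (k : ℕ) (x : VilGroup m) :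
    vCoef m μ f k * vilenkin m k x = ∫ y, f y * vilenkin m k (x - y) ∂μ := by
  rw [vCoef, ← integral_mul_const]
  refine integral_congr_ae (.of_forall fun y => ?_)
  simp only [vilenkin_sub]
  ring

lemma integrable_mul_vilenkinDirichlet_sub (hf : Integrable f μ) (k : ℕ) (x : VilGroup m) :
    Integrable (fun y => f y * vilenkinDirichlet m k (x - y)) μ := by
  simp_rw [vilenkinDirichlet, Finset.mul_sum]
  exact integrable_finsetSum _ fun j _ => integrable_mul_vilenkin_sub hf j x

lemma vPartialSum_eq_integral (hf : Integrable f μ) (k : ℕ) (x : VilGroup m) :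
    vPartialSum m μ f k x = ∫ y, f y * vilenkinDirichlet m k (x - y) ∂μ := by
  simp_rw [vPartialSum, vCoef_mul_vilenkin, vilenkinDirichlet, Finset.mul_sum]
  rw [integral_finsetSum _ fun j _ => integrable_mul_vilenkin_sub hf j x]

lemma sum_vPartialSum_eq_integral (hf : Integrable f μ) (n : ℕ) (x : VilGroup m) :
    ∑ k ∈ Finset.range n, vPartialSum m μ f k x = ∫ y, f y * fejerSum m n (x - y) ∂μ := by
  simp_rw [vPartialSum_eq_integral hf, fejerSum, Finset.mul_sum]
  rw [integral_finsetSum _ fun k _ => integrable_mul_vilenkinDirichlet_sub hf k x]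

omit [∀ k, NeZero (m k)] in
lemma vCoef_congr_ae {g : VilGroup m → ℂ} (h : f =ᵐ[μ] g) (k : ℕ) :
    vCoef m μ f k = vCoef m μ g k :=
  integral_congr_ae (h.mono fun x hx => by simp only [hx])

omit [∀ k, NeZero (m k)] in
lemma vFejerMean_congr_ae {g : VilGroup m → ℂ} (h : f =ᵐ[μ] g) :
    vFejerMean m μ f = vFejerMean m μ g := by
  ext n x
  simp_rw [vFejerMean, vPartialSum, vCoef_congr_ae h]

lemma vFejerMean_sub {g : VilGroup m → ℂ} (hf : Integrable f μ) (hg : Integrable g μ) (n : ℕ)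
    (x : VilGroup m) :
    vFejerMean m μ (f - g) n x = vFejerMean m μ f n x - vFejerMean m μ g n x := by
  simp_rw [vFejerMean, vPartialSum_eq_integral hf, vPartialSum_eq_integral hg,
    vPartialSum_eq_integral (hf.sub hg), Pi.sub_apply, sub_mul]
  rw [← mul_sub, ← Finset.sum_sub_distrib]
  simp_rw [integral_sub (integrable_mul_vilenkinDirichlet_sub hf _ x)
    (integrable_mul_vilenkinDirichlet_sub hg _ x)]

omit [∀ k, NeZero (m k)] in
lemma measurableSet_puncturedCyl (l s : ℕ) : MeasurableSet (puncturedCyl m l s) := by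
  have : puncturedCyl m l s =
      ⋂ j, ⋂ (_ : j < l), ⋂ (_ : j ≠ s), (fun y : VilGroup m => y j) ⁻¹' {0} := by
    ext y; simp [puncturedCyl]
  rw [this]
  exact .iInter fun j => .iInter fun _ => .iInter fun _ => measurable_pi_apply j (.singleton _)

omit [∀ k, NeZero (m k)] in
lemma measurable_fejerMajorant (l : ℕ) : Measurable (fejerMajorant m l) :=
  Finset.measurable_fun_sum _ fun s _ =>
    (measurable_const.indicator (measurableSet_puncturedCyl l s)).const_mul _

omit [∀ k, NeZero (m k)] in
lemma lintegral_mul_fejerMajorant {g : VilGroup m → ENNReal} (hg : Measurable g) (l : ℕ)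
    (x : VilGroup m) :
    ∫⁻ y, g y * (fejerMajorant m l (x - y) : ENNReal) ∂μ = majorantConv μ g l x := by
  have hS : ∀ s, MeasurableSet {y | x - y ∈ puncturedCyl m l s} := fun s =>
    measurable_const_sub x (measurableSet_puncturedCyl l s)
  have h : ∀ y, g y * (fejerMajorant m l (x - y) : ENNReal) = ∑ s ∈ Finset.range (l + 1),
      Mgen m s * {y | x - y ∈ puncturedCyl m l s}.indicator g y := by
    intro y
    simp only [fejerMajorant, Nat.cast_sum, Nat.cast_mul, Finset.mul_sum]
    refine Finset.sum_congr rfl fun s _ => ?_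
    by_cases hy : x - y ∈ puncturedCyl m l s
    · rw [Set.indicator_of_mem hy,
        Set.indicator_of_mem (show y ∈ {y | x - y ∈ puncturedCyl m l s} from hy)]
      simp [mul_comm]
    · rw [Set.indicator_of_notMem hy,
        Set.indicator_of_notMem (show y ∉ {y | x - y ∈ puncturedCyl m l s} from hy)]
      simp
  simp_rw [h]
  rw [lintegral_finsetSum _ fun s _ => (hg.indicator (hS s)).const_mul _]
  refine Finset.sum_congr rfl fun s _ => ?_
  rw [lintegral_const_mul _ (hg.indicator (hS s)), lintegral_indicator (hS s)]

lemma enorm_sum_vPartialSum_le (hm : ∀ k, 2 ≤ m k) {B : ℕ} (hB : ∀ k, m k ≤ B)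
    (hf : Integrable f μ) (hfm : Measurable f) {n L : ℕ} (hn : n < Mgen m L) (x : VilGroup m) :
    ‖∑ k ∈ Finset.range n, vPartialSum m μ f k x‖ₑ ≤ (B ^ 3 + B ^ 2 + B : ℕ) *
      ∑ l ∈ Finset.range L, Mgen m l * majorantConv μ (fun y => ‖f y‖ₑ) l x := by
  have hmeas : ∀ l, Measurable fun y =>
      ‖f y‖ₑ * (fejerMajorant m l (x - y) : ENNReal) := fun l =>
    hfm.enorm.mul (Measurable.of_discrete.comp
      ((measurable_fejerMajorant l).comp (measurable_const_sub x)))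
  rw [sum_vPartialSum_eq_integral hf]
  simp_rw [← lintegral_mul_fejerMajorant hfm.enorm, ← lintegral_const_mul _ (hmeas _)]
  rw [← lintegral_finsetSum _ fun l _ => (hmeas l).const_mul _,
    ← lintegral_const_mul _ (Finset.measurable_fun_sum _ fun l _ => (hmeas l).const_mul _)]
  refine (enorm_integral_le_lintegral_enorm _).trans (lintegral_mono fun y => ?_)
  have h : ‖fejerSum m n (x - y)‖ₑ ≤ (((B ^ 3 + B ^ 2 + B) *
      ∑ l ∈ Finset.range L, Mgen m l * fejerMajorant m l (x - y) : ℕ) : ENNReal) := by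
    rw [← ofReal_norm, ← ENNReal.ofReal_natCast]
    exact ENNReal.ofReal_le_ofReal (norm_fejerSum_le hm hB hn _)
  rw [enorm_mul]
  refine (mul_le_mul_right h _).trans (le_of_eq ?_)
  push_cast
  simp_rw [Finset.mul_sum]
  refine Finset.sum_congr rfl fun l _ => ?_
  ring

/-- The Fejér means are controlled by the maximal operator of the majorants. -/
lemma enorm_vFejerMean_le (hm : ∀ k, 2 ≤ m k) {B : ℕ} (hB : ∀ k, m k ≤ B)
    (hf : Integrable f μ) (hfm : Measurable f) {x : VilGroup m} {α : ENNReal}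
    (hα : ∀ l, majorantConv μ (fun y => ‖f y‖ₑ) l x ≤ α) (n : ℕ) :
    ‖vFejerMean m μ f n x‖ₑ ≤ 2 * (B ^ 3 + B ^ 2 + B : ℕ) * α := by
  rcases Nat.eq_zero_or_pos n with rfl | hn
  · simp [vFejerMean]
  obtain ⟨L, hL, hmin⟩ : ∃ L, n < Mgen m L ∧ ∀ L' < L, ¬ n < Mgen m L' := by
    classical
    have hex : ∃ L, n < Mgen m L := ⟨n, lt_Mgen hm n⟩
    exact ⟨Nat.find hex, Nat.find_spec hex, fun _ h => Nat.find_min hex h⟩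
  have hsum : ∑ l ∈ Finset.range L, Mgen m l ≤ 2 * n := by
    cases L with
    | zero => simp
    | succ L =>
      rw [Finset.sum_range_succ]
      have h1 := sum_Mgen_le hm L
      have h2 := hmin L L.lt_succ_self
      omega
  have hn0 : (n : ENNReal) ≠ 0 := by exact_mod_cast hn.ne'
  rw [vFejerMean, enorm_mul]
  have h1 : ‖(1 / n : ℂ)‖ₑ = (n : ENNReal)⁻¹ := by
    rw [one_div, enorm_inv (by exact_mod_cast hn.ne'), ← ofReal_norm, norm_natCast,
      ENNReal.ofReal_natCast]
  rw [h1]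
  calc (n : ENNReal)⁻¹ * ‖∑ k ∈ Finset.range n, vPartialSum m μ f k x‖ₑ
      ≤ (n : ENNReal)⁻¹ * ((B ^ 3 + B ^ 2 + B : ℕ) * ((2 * n : ℕ) * α)) := by
        gcongr
        refine (enorm_sum_vPartialSum_le hm hB hf hfm hL x).trans ?_
        gcongr
        calc ∑ l ∈ Finset.range L, Mgen m l * majorantConv μ (fun y => ‖f y‖ₑ) l x
            ≤ ∑ l ∈ Finset.range L, Mgen m l * α := by
              gcongr with l
              exact hα l
          _ = (∑ l ∈ Finset.range L, Mgen m l : ℕ) * α := by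
              rw [← Finset.sum_mul]; push_cast; rfl
          _ ≤ _ := by gcongr
    _ = ((n : ENNReal)⁻¹ * n) * (2 * (B ^ 3 + B ^ 2 + B : ℕ) * α) := by push_cast; ring
    _ = _ := by rw [ENNReal.inv_mul_cancel hn0 (ENNReal.natCast_ne_top _), one_mul]

end Convolution

section Polynomials

variable {m : ℕ → ℕ} [∀ k, NeZero (m k)] {μ : Measure (VilGroup m)} {P : VilGroup m → ℂ}

lemma vCoef_eq_zero (hm : ∀ k, 2 ≤ m k) [IsProbabilityMeasure μ] (hμ : IsVilHaar m μ) {N : ℕ}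
    (hP : DependsOn P (Set.Iio N)) {j : ℕ} (hj : Mgen m N ≤ j) : vCoef m μ P j = 0 := by
  have := hμ.isAddRightInvariant
  obtain ⟨l, hNl, hl⟩ := exists_vDigit_ne_zero hm hj
  set e : VilGroup m := Pi.single l 1 with he
  have hlj : l ≤ j := by
    by_contra! hc
    exact hl (vDigit_eq_zero (hc.trans (lt_Mgen hm l)))
  have hψ : vilenkin m j e ≠ 1 := by
    have h1 : vilenkin m j e = ZMod.stdAddChar ((vDigit m j l : ℕ) : ZMod (m l)) := by
      rw [vilenkin, Finset.prod_eq_single l]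
      · rw [rademacher_eq_stdAddChar, ← AddChar.map_nsmul_eq_pow, he]
        simp
      · intro i _ hi
        rw [rademacher_eq_one_iff.2 (by simp [he, hi]), one_pow]
      · intro h
        simp only [Finset.mem_range] at h
        omega
    rw [h1, ← AddChar.map_zero_eq_one (ZMod.stdAddChar (N := m l)),
      ZMod.injective_stdAddChar.ne_iff, Ne, ZMod.natCast_eq_zero_iff]
    exact Nat.not_dvd_of_pos_of_lt (Nat.pos_of_ne_zero hl)
      (Nat.mod_lt _ (Nat.pos_of_ne_zero (NeZero.ne _)))
  have hshift : ∀ y, P (y + e) = P y := fun y => hP fun i hi => by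
    simp [he, (lt_of_lt_of_le hi hNl).ne]
  have h2 : vCoef m μ P j = vCoef m μ P j * (starRingEnd ℂ) (vilenkin m j e) := by
    conv_lhs => rw [vCoef, ← integral_add_right_eq_self _ e]
    rw [vCoef, ← integral_mul_const]
    refine integral_congr_ae (.of_forall fun y => ?_)
    simp only [hshift, vilenkin_add, map_mul]
    ring
  by_contra h0
  have h3 := mul_left_cancel₀ h0 ((mul_one _).trans h2)
  exact hψ (by simpa using (congrArg (starRingEnd ℂ) h3).symm)

lemma vPartialSum_Mgen (hm : ∀ k, 2 ≤ m k) [IsProbabilityMeasure μ] (hμ : IsVilHaar m μ) {N : ℕ}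
    (hPi : Integrable P μ) (hP : DependsOn P (Set.Iio N)) (x : VilGroup m) :
    vPartialSum m μ P (Mgen m N) x = P x := by
  have hM0 : (Mgen m N : ℂ) ≠ 0 := by exact_mod_cast (Mgen_pos N).ne'
  have hsub : ∀ y, x - y ∈ cylV m N ↔ y ∈ cylVAt m N x := fun y =>
    forall₂_congr fun j _ => by rw [Pi.sub_apply, sub_eq_zero, eq_comm]
  have h : ∀ y, P y * vilenkinDirichlet m (Mgen m N) (x - y) =
      (cylVAt m N x).indicator (fun _ => P x * Mgen m N) y := by
    intro y
    rw [vilenkinDirichlet_Mgen hm, cylInd]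
    by_cases hy : y ∈ cylVAt m N x
    · rw [Set.indicator_of_mem ((hsub y).2 hy), Set.indicator_of_mem hy, hP (y := x) hy]
      simp
    · rw [Set.indicator_of_notMem (fun h => hy ((hsub y).1 h)), Set.indicator_of_notMem hy]
      simp
  rw [vPartialSum_eq_integral hPi]
  simp_rw [h]
  rw [integral_indicator_const _ (measurableSet_cylVAt N x), measureReal_def, hμ]
  simp only [ENNReal.toReal_inv, ENNReal.toReal_natCast, real_smul, ofReal_inv, ofReal_natCast]
  field_simp

lemma tendsto_vFejerMean_of_dependsOn (hm : ∀ k, 2 ≤ m k) [IsProbabilityMeasure μ]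
    (hμ : IsVilHaar m μ) {N : ℕ} (hPi : Integrable P μ) (hP : DependsOn P (Set.Iio N))
    (x : VilGroup m) : Tendsto (fun n => vFejerMean m μ P n x) atTop (nhds (P x)) := by
  have h1 : ∀ k ≥ Mgen m N, vPartialSum m μ P k x = P x := by
    intro k hk
    rw [← vPartialSum_Mgen hm hμ hPi hP x, vPartialSum, vPartialSum]
    refine (Finset.sum_subset (Finset.range_mono hk) fun j _ hj => ?_).symm
    rw [vCoef_eq_zero hm hμ hP (by simpa using hj), zero_mul]
  have h2 : Tendsto (fun k => vPartialSum m μ P k x) atTop (nhds (P x)) :=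
    tendsto_const_nhds.congr' (eventually_atTop.2 ⟨_, fun k hk => (h1 k hk).symm⟩)
  refine h2.cesaro_smul.congr fun n => ?_
  simp [vFejerMean, real_smul]

end Polynomials

section Density

variable {m : ℕ → ℕ} {μ : Measure (VilGroup m)}

lemma iSup_piLE : ⨆ n, (Filtration.piLE (X := fun k => ZMod (m k))) n = MeasurableSpace.pi := by
  refine le_antisymm (iSup_le fun n => Filtration.piLE.le n) (iSup_le fun k => ?_)
  refine le_iSup_of_le k ?_
  rintro _ ⟨t, ht, rfl⟩
  have hk : k ∈ Set.Iic k := Set.mem_Iic.2 le_rfl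
  exact ⟨(fun z : Π i : Set.Iic k, ZMod (m i) => z ⟨k, hk⟩) ⁻¹' t,
    measurable_pi_apply (X := fun i : Set.Iic k => ZMod (m i)) ⟨k, hk⟩ ht, rfl⟩

lemma exists_dependsOn_real [IsProbabilityMeasure μ] {f : VilGroup m → ℝ} (hf : Integrable f μ)
    (hfm : Measurable f) {δ : ENNReal} (hδ : 0 < δ) :
    ∀ᶠ N in atTop, ∃ P : VilGroup m → ℝ, DependsOn P (Set.Iio N) ∧ Measurable P ∧
      Integrable P μ ∧ ∫⁻ x, ‖f x - P x‖ₑ ∂μ ≤ δ := by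
  have h := hf.tendsto_eLpNorm_condExp (ℱ := Filtration.piLE (X := fun k => ZMod (m k)))
    (by rw [iSup_piLE]; exact hfm.stronglyMeasurable)
  obtain ⟨K, hK⟩ := eventually_atTop.1 (ENNReal.tendsto_nhds_zero.1 h δ hδ)
  refine eventually_atTop.2 ⟨K + 1, fun N hN => ?_⟩
  have hsm := stronglyMeasurable_condExp (f := f) (μ := μ)
    (m := Filtration.piLE (X := fun k => ZMod (m k)) K)
  refine ⟨_, fun x y hxy => hsm.dependsOn_of_piLE fun i hi => hxy i (Nat.lt_of_le_of_lt hi hN),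
    (hsm.mono (Filtration.piLE.le K)).measurable, integrable_condExp, ?_⟩
  refine (le_of_eq ?_).trans (hK K le_rfl)
  rw [eLpNorm_one_eq_lintegral_enorm]
  exact lintegral_congr fun x => by rw [Pi.sub_apply, ← enorm_neg, neg_sub]

lemma exists_dependsOn [IsProbabilityMeasure μ] {f : VilGroup m → ℂ} (hf : Integrable f μ)
    (hfm : Measurable f) {δ : ENNReal} (hδ : 0 < δ) :
    ∃ (N : ℕ) (P : VilGroup m → ℂ), DependsOn P (Set.Iio N) ∧ Measurable P ∧
      Integrable P μ ∧ ∫⁻ x, ‖f x - P x‖ₑ ∂μ ≤ δ := by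
  have hδ2 : 0 < δ / 2 := ENNReal.half_pos hδ.ne'
  obtain ⟨N, ⟨P, hPd, hPm, hPi, hP⟩, Q, hQd, hQm, hQi, hQ⟩ :=
    ((exists_dependsOn_real hf.re (measurable_re.comp hfm) hδ2).and
      (exists_dependsOn_real hf.im (measurable_im.comp hfm) hδ2)).exists
  refine ⟨N, fun x => P x + Q x * I, fun x y h => by simp only [hPd h, hQd h],
    (measurable_ofReal.comp hPm).add ((measurable_ofReal.comp hQm).mul_const _),
    hPi.ofReal.add (hQi.ofReal.mul_const _), ?_⟩
  calc ∫⁻ x, ‖f x - (P x + Q x * I)‖ₑ ∂μ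
      ≤ ∫⁻ x, (‖(f x).re - P x‖ₑ + ‖(f x).im - Q x‖ₑ) ∂μ := by
        refine lintegral_mono fun x => ?_
        have : f x - (P x + Q x * I) = ((f x).re - P x : ℝ) + ((f x).im - Q x : ℝ) * I := by
          apply Complex.ext <;> simp
        rw [this]
        refine (enorm_add_le _ _).trans (le_of_eq ?_)
        have hI : ‖I‖ₑ = 1 := by simp [← ofReal_norm]
        rw [enorm_mul, hI, mul_one, ← ofReal_norm, ← ofReal_norm, Complex.norm_real,
          Complex.norm_real, ofReal_norm, ofReal_norm]
    _ ≤ δ / 2 + δ / 2 := by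
        have hre : Measurable fun x => ‖(f x).re - P x‖ₑ :=
          ((measurable_re.comp hfm).sub hPm).enorm
        rw [lintegral_add_left hre]
        exact add_le_add hP hQ
    _ = δ := ENNReal.add_halves δ

end Density

section Convergence

variable {m : ℕ → ℕ} [∀ k, NeZero (m k)] {μ : Measure (VilGroup m)} [IsProbabilityMeasure μ]
  {f : VilGroup m → ℂ}

/-- The weak type (1,1) bound for the maximal operator of the Fejér means. -/
lemma mul_measure_vFejerMean_le (hm : ∀ k, 2 ≤ m k) {B : ℕ} (hB : ∀ k, m k ≤ B)
    (hμ : IsVilHaar m μ) (hf : Integrable f μ) (hfm : Measurable f) (lam : ENNReal) :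
    lam * μ {x | ∃ n, 2 * (B ^ 3 + B ^ 2 + B : ℕ) * ((2 * B + 1) * lam) < ‖vFejerMean m μ f n x‖ₑ} ≤
      3 * ∫⁻ x, ‖f x‖ₑ ∂μ := by
  refine le_trans ?_ (mul_measure_majorantConv_le (lam := lam) hm hB hμ hfm.enorm)
  refine mul_le_mul_right (measure_mono ?_) _
  rintro x ⟨n, hn⟩
  by_contra hc
  exact hn.not_ge (enorm_vFejerMean_le hm hB hf hfm (fun l => not_lt.1 fun h => hc ⟨l, h⟩) n)

lemma ae_eventually_enorm_vFejerMean_sub_le (hm : ∀ k, 2 ≤ m k) {B : ℕ} (hB : ∀ k, m k ≤ B)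
    (hμ : IsVilHaar m μ) (hf : Integrable f μ) (hfm : Measurable f) {ε : ENNReal} (hε : ε ≠ 0) :
    ∀ᵐ x ∂μ, ∀ᶠ n in atTop, ‖vFejerMean m μ f n x - f x‖ₑ ≤ ε := by
  have hB0 : 0 < B := (by omega : 0 < 2).trans_le ((hm 0).trans (hB 0))
  set A : ℕ := 2 * (B ^ 3 + B ^ 2 + B) * (2 * B + 1) with hA
  have hA0 : (A : ENNReal) ≠ 0 := by exact_mod_cast (by positivity : A ≠ 0)
  have hA1 : (1 : ENNReal) ≤ A := by exact_mod_cast (by positivity : 0 < A)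
  have hε3 : 0 < ε / 3 := ENNReal.div_pos hε (by simp)
  set lam : ENNReal := ε / 3 / A with hlam
  have hlam0 : lam ≠ 0 := (ENNReal.div_pos hε3.ne' (ENNReal.natCast_ne_top _)).ne'
  have hlamε : lam ≤ ε / 3 := ENNReal.div_le_of_le_mul (le_mul_of_one_le_right' hA1)
  have hAlam : 2 * (B ^ 3 + B ^ 2 + B : ℕ) * ((2 * B + 1) * lam) = ε / 3 := by
    rw [← ENNReal.mul_div_cancel hA0 (ENNReal.natCast_ne_top _) (b := ε / 3), ← hlam, hA]
    push_cast
    ring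
  set E := {x | ¬ ∀ᶠ n in atTop, ‖vFejerMean m μ f n x - f x‖ₑ ≤ ε}
  have key : ∀ δ : ENNReal, 0 < δ → lam * μ E ≤ 4 * δ := by
    intro δ hδ
    obtain ⟨N, P, hPd, hPm, hPi, hP⟩ := exists_dependsOn hf hfm hδ
    have hsub : E ⊆ {x | ∃ n, 2 * (B ^ 3 + B ^ 2 + B : ℕ) * ((2 * B + 1) * lam) <
        ‖vFejerMean m μ (f - P) n x‖ₑ} ∪ {x | lam ≤ ‖f x - P x‖ₑ} := by
      intro x hx
      by_contra hc
      simp only [Set.mem_union, Set.mem_ofPred_eq, not_or, not_exists, not_lt, not_le] at hc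
      refine hx ?_
      have ht := tendsto_iff_edist_tendsto_0.1 (tendsto_vFejerMean_of_dependsOn hm hμ hPi hPd x)
      filter_upwards [ENNReal.tendsto_nhds_zero.1 ht _ hε3] with n hn
      rw [edist_eq_enorm_sub] at hn
      have h1 := hc.1 n
      rw [hAlam, vFejerMean_sub hf hPi] at h1
      have h2 : ‖P x - f x‖ₑ ≤ ε / 3 := by
        rw [← enorm_neg, neg_sub]
        exact hc.2.le.trans hlamε
      calc ‖vFejerMean m μ f n x - f x‖ₑ
          = ‖(vFejerMean m μ f n x - vFejerMean m μ P n x) +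
              (vFejerMean m μ P n x - P x) + (P x - f x)‖ₑ := by congr 1; ring
        _ ≤ ε / 3 + ε / 3 + ε / 3 :=
            (enorm_add_le _ _).trans (add_le_add ((enorm_add_le _ _).trans (add_le_add h1 hn)) h2)
        _ = ε := ENNReal.add_thirds ε
    calc lam * μ E ≤ lam * μ {x | ∃ n, 2 * (B ^ 3 + B ^ 2 + B : ℕ) * ((2 * B + 1) * lam) <
          ‖vFejerMean m μ (f - P) n x‖ₑ} + lam * μ {x | lam ≤ ‖f x - P x‖ₑ} := by
          rw [← mul_add]
          gcongr
          exact (measure_mono hsub).trans (measure_union_le _ _)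
      _ ≤ 3 * ∫⁻ x, ‖f x - P x‖ₑ ∂μ + ∫⁻ x, ‖f x - P x‖ₑ ∂μ :=
          add_le_add (mul_measure_vFejerMean_le hm hB hμ (hf.sub hPi) (hfm.sub hPm) lam)
            (mul_meas_ge_le_lintegral (hfm.sub hPm).enorm _)
      _ ≤ 3 * δ + δ := by gcongr
      _ = 4 * δ := by ring
  have h0 : lam * μ E ≤ 0 := by
    refine ENNReal.le_of_forall_pos_le_add fun δ hδ _ => ?_
    rw [zero_add, ← ENNReal.mul_div_cancel (a := 4) (b := δ) (by simp) (by simp)]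
    exact key _ (ENNReal.div_pos (by exact_mod_cast hδ.ne') (by simp))
  exact (mul_eq_zero.1 (le_zero_iff.1 h0)).resolve_left hlam0

lemma ae_tendsto_vFejerMean (hm : ∀ k, 2 ≤ m k) {B : ℕ} (hB : ∀ k, m k ≤ B)
    (hμ : IsVilHaar m μ) (hf : Integrable f μ) (hfm : Measurable f) :
    ∀ᵐ x ∂μ, Tendsto (fun n => vFejerMean m μ f n x) atTop (nhds (f x)) := by
  have h : ∀ᵐ x ∂μ, ∀ k : ℕ, ∀ᶠ n in atTop,
      ‖vFejerMean m μ f n x - f x‖ₑ ≤ (k : ENNReal)⁻¹ :=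
    ae_all_iff.2 fun k => ae_eventually_enorm_vFejerMean_sub_le hm hB hμ hf hfm
      (ENNReal.inv_ne_zero.2 (ENNReal.natCast_ne_top k))
  filter_upwards [h] with x hx
  refine tendsto_iff_edist_tendsto_0.2 (ENNReal.tendsto_nhds_zero.2 fun ε hε => ?_)
  obtain ⟨k, hk⟩ := ENNReal.exists_inv_nat_lt hε.ne'
  filter_upwards [hx k] with n hn
  rw [edist_eq_enorm_sub]
  exact hn.trans hk.le

end Convergence

/-- **Almost everywhere convergence of Vilenkin-Fejér means.**
If `f ∈ L_1(G_m)` on a bounded Vilenkin group, then `σ_n^ψ f → f` a.e. as `n → ∞`. -/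
theorem vilenkin_fejer_ae_convergence
    (m : ℕ → ℕ) (hm : ∀ k, 2 ≤ m k) (hbd : ∃ B, ∀ k, m k ≤ B)
    (μ : Measure (VilGroup m)) [IsProbabilityMeasure μ] (hμ : IsVilHaar m μ)
    (f : VilGroup m → ℂ) (hf : Integrable f μ) :
    ∀ᵐ x ∂μ, Tendsto (fun n : ℕ => vFejerMean m μ f n x) atTop (nhds (f x)) := by
  have : ∀ k, NeZero (m k) := fun k => ⟨by have := hm k; omega⟩
  obtain ⟨B, hB⟩ := hbd
  have hae := hf.1.ae_eq_mk
  filter_upwards [hae, ae_tendsto_vFejerMean hm hB hμ (hf.congr hae)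
    hf.1.stronglyMeasurable_mk.measurable] with x hx h
  rwa [vFejerMean_congr_ae hae, hx]
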